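/- arXiv:1805.00884 — 2 statements merged into one kernel-verified Lean document; each statement's English description precedes it below -/
import Mathlib

section
/- Let ε > 0 and let u : ℝ → ℂ be continuous with compact support. Define, for y ∈ (0, ε) and t ∈ (-π/ε, π/ε), (Gu)(y,t) := √(ε/(2π)) · Σ_{n ∈ ℤ} u(y + εn) · exp(-i t (y + εn)). Then ∫_{0}^{ε} ∫_{-π/ε}^{π/ε} |(Gu)(y,t)|² dt dy = ∫_{ℝ} |u(x)|² dx; i.e., the Gelfand transform G is an isometry from (compactly supported continuous functions in) L²(ℝ) into L²((0,ε) × (-π/ε, π/ε)). -/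
open MeasureTheory

/-- Orthogonality of the exponentials `t ↦ exp (i ε k t)` on `(-π/ε, π/ε)`. -/
lemma integral_exp_period (ε : ℝ) (hε : 0 < ε) (k : ℤ) :
    (∫ t in (-(Real.pi / ε))..(Real.pi / ε), Complex.exp (Complex.I * (ε * k) * (t : ℂ)))
      = if k = 0 then (2 * Real.pi / ε : ℂ) else 0 := by
  have hε' : (ε : ℂ) ≠ 0 := by exact_mod_cast hε.ne'
  split_ifs with hk
  · subst hk
    simp
    ring
  · have hk' : (k : ℂ) ≠ 0 := by exact_mod_cast hk
    rw [integral_exp_mul_complex (by simp [hk', hε'])]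
    have h : Complex.exp (Complex.I * (ε * k) * ((Real.pi / ε : ℝ) : ℂ))
        = Complex.exp (Complex.I * (ε * k) * ((-(Real.pi / ε) : ℝ) : ℂ)) := by
      rw [Complex.exp_eq_exp_iff_exists_int]
      refine ⟨k, ?_⟩
      push_cast
      field_simp
      ring
    rw [h, sub_self, zero_div]

/-- Parseval's identity for the finite exponential sums in the Gelfand transform. -/
lemma integral_norm_sq_exp_sum (ε : ℝ) (hε : 0 < ε) (y : ℝ) (c : ℤ → ℂ) (S : Finset ℤ) :
    (∫ t in (-(Real.pi / ε))..(Real.pi / ε),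
        ‖(Real.sqrt (ε / (2 * Real.pi)) : ℂ) * ∑ n ∈ S, c n *
          Complex.exp (-(Complex.I * (t : ℂ) * ((y + ε * n : ℝ) : ℂ)))‖ ^ 2)
      = ∑ n ∈ S, ‖c n‖ ^ 2 := by
  have hε' : (ε : ℂ) ≠ 0 := by exact_mod_cast hε.ne'
  have hπ : (Real.pi : ℂ) ≠ 0 := by exact_mod_cast Real.pi_ne_zero
  apply Complex.ofReal_injective
  rw [← intervalIntegral.integral_ofReal]
  have key : ∀ t : ℝ, ((‖(Real.sqrt (ε / (2 * Real.pi)) : ℂ) * ∑ n ∈ S, c n *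
          Complex.exp (-(Complex.I * (t : ℂ) * ((y + ε * n : ℝ) : ℂ)))‖ ^ 2 : ℝ) : ℂ)
      = ∑ n ∈ S, ∑ m ∈ S, (ε / (2 * Real.pi) * (c n * (starRingEnd ℂ) (c m))) *
          Complex.exp (Complex.I * (ε * (m - n : ℤ)) * (t : ℂ)) := by
    intro t
    rw [norm_mul, mul_pow, Complex.norm_real, Real.norm_of_nonneg (Real.sqrt_nonneg _),
      Real.sq_sqrt (by positivity)]
    push_cast
    rw [← Complex.mul_conj', map_sum, Finset.sum_mul_sum, Finset.mul_sum]
    refine Finset.sum_congr rfl fun n _ => ?_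
    rw [Finset.mul_sum]
    refine Finset.sum_congr rfl fun m _ => ?_
    have he : Complex.exp (Complex.I * (ε * (m - n)) * (t : ℂ))
        = Complex.exp (-(Complex.I * t * (y + ε * n)))
          * (starRingEnd ℂ) (Complex.exp (-(Complex.I * t * (y + ε * m)))) := by
      rw [← Complex.exp_conj, ← Complex.exp_add]
      congr 1
      simp
      ring
    rw [he, map_mul]
    ring
  simp_rw [key]
  rw [intervalIntegral.integral_finsetSum
    fun n _ => Continuous.intervalIntegrable (by fun_prop) _ _]
  rw [Complex.ofReal_sum]
  refine Finset.sum_congr rfl fun n hn => ?_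
  rw [intervalIntegral.integral_finsetSum
    fun n _ => Continuous.intervalIntegrable (by fun_prop) _ _]
  simp_rw [intervalIntegral.integral_const_mul, integral_exp_period ε hε, sub_eq_zero]
  simp only [mul_ite, mul_zero, Finset.sum_ite_eq', hn, if_true]
  rw [Complex.ofReal_pow, ← Complex.mul_conj']
  field_simp

/-- The integral over `ℝ` is the sum of the integrals of all translates over one period. -/
lemma hasSum_integral_translates {f : ℝ → ℝ} (hf : Integrable f) (ε : ℝ) (hε : 0 < ε) :
    HasSum (fun n : ℤ => ∫ y in (0 : ℝ)..ε, f (y + ε * n)) (∫ x, f x) := by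
  have h := hasSum_integral_iUnion (μ := volume) (f := f)
    (fun n : ℤ => measurableSet_Ioc (a := n • ε) (b := (n + 1) • ε))
    (Set.pairwise_disjoint_Ioc_zsmul ε) hf.integrableOn
  rw [iUnion_Ioc_zsmul hε, setIntegral_univ] at h
  have hperiod : ∀ n : ℤ, ∫ y in (0 : ℝ)..ε, f (y + ε * n)
      = ∫ x in Set.Ioc (n • ε) ((n + 1) • ε), f x := by
    intro n
    rw [intervalIntegral.integral_comp_add_right (fun x => f x),
      intervalIntegral.integral_of_le (by linarith)]
    congr 3 <;> simp <;> ring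
  simpa only [hperiod] using h

/-- Only finitely many translates of a compact set along `εℤ` meet a bounded interval. -/
lemma exists_finset_translate_eq_zero (ε : ℝ) (hε : 0 < ε) {u : ℝ → ℂ}
    (hsupp : HasCompactSupport u) :
    ∃ S : Finset ℤ, ∀ y ∈ Set.uIcc 0 ε, ∀ n ∉ S, u (y + ε * n) = 0 := by
  obtain ⟨R, hR⟩ := hsupp.isCompact.isBounded.subset_closedBall 0
  obtain ⟨N, hN⟩ := exists_nat_gt (R / ε + 1)
  refine ⟨Finset.Icc (-N) N, fun y hy n hn => ?_⟩
  by_contra h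
  apply hn
  rw [Set.uIcc_of_le hε.le] at hy
  have hx := hR (subset_tsupport u h)
  rw [mem_closedBall_zero_iff, Real.norm_eq_abs, abs_le] at hx
  have hNR : R + ε < ε * N := by
    have := mul_lt_mul_of_pos_left hN hε
    rwa [mul_add, mul_div_cancel₀ _ hε.ne', mul_one] at this
  rw [Finset.mem_Icc]
  constructor
  · have : (-N : ℝ) ≤ n := by
      refine le_of_mul_le_mul_left ?_ hε
      linarith [hy.1, hy.2, hx.1]
    exact_mod_cast this
  · have : (n : ℝ) ≤ N := by
      refine le_of_mul_le_mul_left ?_ hε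
      linarith [hy.1, hy.2, hx.2]
    exact_mod_cast this


/-- The Gelfand transform `(Gu)(y,t) = √(ε/(2π)) Σ_{n∈ℤ} u(y+εn) e^{-it(y+εn)}`
is an isometry from compactly supported continuous functions in `L²(ℝ)`
into `L²((0,ε) × (-π/ε, π/ε))`. -/
theorem gelfand_transform_isometry
    (ε : ℝ) (hε : 0 < ε) (u : ℝ → ℂ)
    (hu : Continuous u) (hsupp : HasCompactSupport u) :
    (∫ y in (0:ℝ)..ε, ∫ t in (-(Real.pi / ε))..(Real.pi / ε),
        ‖(Real.sqrt (ε / (2 * Real.pi)) : ℂ) *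
            ∑' n : ℤ, u (y + ε * n) *
              Complex.exp (-(Complex.I * (t : ℂ) * ((y + ε * n : ℝ) : ℂ)))‖ ^ 2)
      = ∫ x : ℝ, ‖u x‖ ^ 2 := by
  obtain ⟨S, hS⟩ := exists_finset_translate_eq_zero ε hε hsupp
  have hint : Integrable fun x => ‖u x‖ ^ 2 :=
    (by fun_prop : Continuous fun x => ‖u x‖ ^ 2).integrable_of_hasCompactSupport
      (hsupp.comp_left (g := fun z : ℂ => ‖z‖ ^ 2) (by simp))
  calc
    _ = ∫ y in (0:ℝ)..ε, ∑ n ∈ S, ‖u (y + ε * n)‖ ^ 2 := by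
      refine intervalIntegral.integral_congr fun y hy => ?_
      rw [← integral_norm_sq_exp_sum ε hε y (fun n => u (y + ε * n)) S]
      refine intervalIntegral.integral_congr fun t _ => ?_
      rw [tsum_eq_sum fun n hn => by rw [hS y hy n hn, zero_mul]]
    _ = ∑ n ∈ S, ∫ y in (0:ℝ)..ε, ‖u (y + ε * n)‖ ^ 2 :=
      intervalIntegral.integral_finsetSum
        fun n _ => Continuous.intervalIntegrable (by fun_prop) _ _
    _ = ∫ x : ℝ, ‖u x‖ ^ 2 := by
      rw [← (hasSum_integral_translates hint ε hε).tsum_eq]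
      refine (tsum_eq_sum fun n hn => ?_).symm
      rw [intervalIntegral.integral_congr (g := fun _ => 0) fun y hy => by simp [hS y hy n hn]]
      simp
end

section
/- Let a₁, a₂ > 0, l⁽¹⁾, l⁽²⁾, l⁽³⁾ > 0, τ ∈ ℝ, and z ∈ ℂ be such that z ≠ (πj/l⁽¹⁾)² and z ≠ (πj/l⁽²⁾)² for every positive integer j, and sin(l⁽¹⁾√z) ≠ 0, sin(l⁽²⁾√z) ≠ 0, cos(l⁽²⁾√z/2) ≠ 0, for a fixed square root √z. Then (1/l⁽³⁾) · { -4 z a₁² l⁽¹⁾ Σ_{j=1}^{∞} (1 + (-1)^{j+1} cos τ)/( (πj)² - (l⁽¹⁾√z)² ) + (2a₁²/l⁽¹⁾)(1 - cos τ) - 4 z a₂² l⁽²⁾ Σ_{j=1}^{∞} (1 + (-1)^{j+1})/( (πj)² - (l⁽²⁾√z)² ) } = (2√z/l⁽³⁾) · { a₁² ( cos(l⁽¹⁾√z) - cos τ )/sin(l⁽¹⁾√z) - a₂² tan( l⁽²⁾√z / 2 ) }. -/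
/-- The Mittag-Leffler expansion of the cotangent, in partial fractions in `w ^ 2`. -/
theorem hasSum_one_div_pi_sq_sub_sq {w : ℂ} (hw : Complex.sin w ≠ 0) :
    HasSum (fun j : ℕ => 1 / (((Real.pi * ((j : ℝ) + 1) : ℝ) : ℂ) ^ 2 - w ^ 2))
      ((1 / w - Complex.cos w / Complex.sin w) / (2 * w)) := by
  have hπ : (Real.pi : ℂ) ≠ 0 := Complex.ofReal_ne_zero.mpr Real.pi_ne_zero
  have hw0 : w ≠ 0 := by rintro rfl; simp at hw
  obtain ⟨x, rfl⟩ : ∃ x : ℂ, w = Real.pi * x := ⟨w / Real.pi, by field_simp⟩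
  have hx0 : x ≠ 0 := right_ne_zero_of_mul hw0
  have hx : x ∈ Complex.integerComplement := by
    rintro ⟨n, rfl⟩
    exact hw (Complex.sin_eq_zero_iff.mpr ⟨n, mul_comm _ _⟩)
  have hsum : HasSum (cotTerm x) (Real.pi * Complex.cot (Real.pi * x) - 1 / x) := by
    rw [cot_series_rep' hx]
    exact (summable_cotTerm hx).hasSum
  have hval : (1 / (Real.pi * x) - Complex.cos (Real.pi * x) / Complex.sin (Real.pi * x))
      / (2 * (Real.pi * x))
      = -1 / (2 * x * Real.pi ^ 2) * (Real.pi * Complex.cot (Real.pi * x) - 1 / x) := by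
    rw [Complex.cot_eq_cos_div_sin]
    field_simp
    ring
  rw [hval]
  refine (hsum.mul_left (-1 / (2 * x * Real.pi ^ 2))).congr_fun fun j => ?_
  have h1 : x + (j + 1) ≠ 0 := by
    simpa using Complex.integerComplement_add_ne_zero hx ((j : ℤ) + 1)
  have h2 : x - (j + 1) ≠ 0 := by
    simpa [sub_eq_add_neg] using Complex.integerComplement_add_ne_zero hx (-(j + 1) : ℤ)
  have h3 : ((Real.pi * ((j : ℝ) + 1) : ℝ) : ℂ) ^ 2 - (Real.pi * x) ^ 2
      = -(Real.pi ^ 2 * ((x + (j + 1)) * (x - (j + 1)))) := by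
    push_cast; ring
  rw [cotTerm_identity hx, h3]
  field_simp

/-- The Mittag-Leffler expansions of the cotangent and the cosecant, combined. -/
theorem hasSum_one_add_alternating_div_pi_sq_sub_sq {w : ℂ} (hw : Complex.sin w ≠ 0) (c : ℂ) :
    HasSum (fun j : ℕ => (1 + (-1 : ℂ) ^ ((j + 1) + 1) * c) /
        (((Real.pi * ((j : ℝ) + 1) : ℝ) : ℂ) ^ 2 - w ^ 2))
      (((1 - c) / w - (Complex.cos w - c) / Complex.sin w) / (2 * w)) := by
  have hw0 : w ≠ 0 := by rintro rfl; simp at hw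
  have hdouble : Complex.sin w = 2 * Complex.sin (w / 2) * Complex.cos (w / 2) := by
    rw [← Complex.sin_two_mul, mul_div_cancel₀ w two_ne_zero]
  have hcos : Complex.cos w = 2 * Complex.cos (w / 2) ^ 2 - 1 := by
    rw [← Complex.cos_two_mul, mul_div_cancel₀ w two_ne_zero]
  have hs : Complex.sin (w / 2) ≠ 0 := fun h => hw (by simp [hdouble, h])
  have hc : Complex.cos (w / 2) ≠ 0 := fun h => hw (by simp [hdouble, h])
  have heven : HasSum (fun j : ℕ => (1 + (-1 : ℂ) ^ (j + 1)) /
      (((Real.pi * ((j : ℝ) + 1) : ℝ) : ℂ) ^ 2 - w ^ 2))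
      (1 / 2 * ((1 / (w / 2) - Complex.cos (w / 2) / Complex.sin (w / 2)) / (2 * (w / 2)))) := by
    have hinj : Function.Injective fun m : ℕ => 2 * m + 1 := fun a b h => by
      simpa using h
    rw [← hinj.hasSum_iff]
    · refine ((hasSum_one_div_pi_sq_sub_sq hs).mul_left (1 / 2)).congr_fun fun m => ?_
      have hden : ((Real.pi * (((2 * m + 1 : ℕ) : ℝ) + 1) : ℝ) : ℂ) ^ 2 - w ^ 2
          = 4 * (((Real.pi * ((m : ℝ) + 1) : ℝ) : ℂ) ^ 2 - (w / 2) ^ 2) := by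
        push_cast; ring
      have hsign : (-1 : ℂ) ^ (2 * m + 1 + 1) = 1 := Even.neg_one_pow ⟨m + 1, by ring⟩
      rw [Function.comp_apply, hden, hsign, ← div_div]
      ring
    · intro j hj
      have hodd : Odd (j + 1) := by
        rw [← Nat.not_even_iff_odd, Nat.even_add_one, not_not, ← Nat.not_odd_iff_even]
        rintro ⟨m, rfl⟩
        exact hj ⟨m, rfl⟩
      simp [hodd.neg_one_pow]
  have hval : ((1 - c) / w - (Complex.cos w - c) / Complex.sin w) / (2 * w)
      = (1 + c) * ((1 / w - Complex.cos w / Complex.sin w) / (2 * w)) - c * (1 / 2 *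
        ((1 / (w / 2) - Complex.cos (w / 2) / Complex.sin (w / 2)) / (2 * (w / 2)))) := by
    rw [hcos, hdouble]
    field_simp
    ring
  rw [hval]
  refine (((hasSum_one_div_pi_sq_sub_sq hw).mul_left (1 + c)).sub
    (heven.mul_left c)).congr_fun fun j => ?_
  rw [pow_succ _ (j + 1)]
  ring

/-- The effective dispersion function of Example (2): the spectral-decomposition
expression over the Dirichlet eigenvalues of the two soft edges equals the closed
formula `(2√z/l₃){a₁²(cos(l₁√z)-cos τ)/sin(l₁√z) - a₂² tan(l₂√z/2)}`. -/
theorem dispersion_example2_identity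
    (a₁ a₂ l₁ l₂ l₃ : ℝ) (ha₁ : 0 < a₁) (ha₂ : 0 < a₂)
    (hl₁ : 0 < l₁) (hl₂ : 0 < l₂) (hl₃ : 0 < l₃)
    (τ : ℝ) (z k : ℂ) (hk : k ^ 2 = z)
    (hz₁ : ∀ j : ℕ, 0 < j → z ≠ ((Real.pi * (j : ℝ) / l₁ : ℝ) : ℂ) ^ 2)
    (hz₂ : ∀ j : ℕ, 0 < j → z ≠ ((Real.pi * (j : ℝ) / l₂ : ℝ) : ℂ) ^ 2)
    (hs₁ : Complex.sin ((l₁ : ℂ) * k) ≠ 0)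
    (hs₂ : Complex.sin ((l₂ : ℂ) * k) ≠ 0)
    (hc₂ : Complex.cos ((l₂ : ℂ) * k / 2) ≠ 0) :
    (1 / (l₃ : ℂ)) *
        (-(4 * z * (a₁ : ℂ) ^ 2 * (l₁ : ℂ)) *
              ∑' j : ℕ, (1 + (-1 : ℂ) ^ ((j + 1) + 1) * (Real.cos τ : ℂ)) /
                (((Real.pi * ((j : ℝ) + 1) : ℝ) : ℂ) ^ 2 - ((l₁ : ℂ) * k) ^ 2)
          + ((2 * a₁ ^ 2 / l₁ : ℝ) : ℂ) * (1 - (Real.cos τ : ℂ))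
          - (4 * z * (a₂ : ℂ) ^ 2 * (l₂ : ℂ)) *
              ∑' j : ℕ, (1 + (-1 : ℂ) ^ ((j + 1) + 1)) /
                (((Real.pi * ((j : ℝ) + 1) : ℝ) : ℂ) ^ 2 - ((l₂ : ℂ) * k) ^ 2))
      = (2 * k / (l₃ : ℂ)) *
          ((a₁ : ℂ) ^ 2 * (Complex.cos ((l₁ : ℂ) * k) - (Real.cos τ : ℂ))
              / Complex.sin ((l₁ : ℂ) * k)
            - (a₂ : ℂ) ^ 2 * Complex.tan ((l₂ : ℂ) * k / 2)) := by
  have hl₁' : (l₁ : ℂ) ≠ 0 := Complex.ofReal_ne_zero.mpr hl₁.ne'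
  have hl₂' : (l₂ : ℂ) ≠ 0 := Complex.ofReal_ne_zero.mpr hl₂.ne'
  have hk0 : k ≠ 0 := by rintro rfl; simp at hs₁
  have h₂ := hasSum_one_add_alternating_div_pi_sq_sub_sq hs₂ 1
  simp only [mul_one] at h₂
  have htan : Complex.tan ((l₂ : ℂ) * k / 2)
      = (1 - Complex.cos ((l₂ : ℂ) * k)) / Complex.sin ((l₂ : ℂ) * k) := by
    have hdouble := Complex.sin_two_mul ((l₂ : ℂ) * k / 2)
    have hcos := Complex.cos_two_mul' ((l₂ : ℂ) * k / 2)
    rw [mul_div_cancel₀ _ two_ne_zero] at hdouble hcos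
    rw [Complex.tan_eq_sin_div_cos, div_eq_div_iff hc₂ hs₂, hdouble, hcos]
    linear_combination
      Complex.cos ((l₂ : ℂ) * k / 2) * Complex.sin_sq_add_cos_sq ((l₂ : ℂ) * k / 2)
  rw [(hasSum_one_add_alternating_div_pi_sq_sub_sq hs₁ _).tsum_eq, h₂.tsum_eq, htan, ← hk]
  push_cast
  field_simp
  ring
end
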